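/- (Kantorovich–Rubinstein duality.) Let X be a standard Borel space, let d : X × X → [0,1] be a measurable pseudometric, and let μ, ν be Borel probability measures on X. Then ⨅_{κ coupling of μ,ν} ∫ d dκ = ⨆_h ( ∫ h dμ − ∫ h dν ), where the supremum ranges over all universally measurable functions h : X → [0,1] that are nonexpansive with respect to d, i.e., h(x) − h(y) ≤ d(x,y) for all x, y ∈ X. -/

import Mathlib

open MeasureTheory

/-- A coupling of two probability measures `μ` and `ν` on `X`. -/
def IsCoupling {X : Type*} [MeasurableSpace X]
    (κ : Measure (X × X)) (μ ν : Measure X) : Prop :=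
  IsProbabilityMeasure κ ∧ κ.map Prod.fst = μ ∧ κ.map Prod.snd = ν

/-- A function `h : X → ℝ` is universally measurable if for every (Borel) probability
measure `μ'` on `X` it agrees `μ'`-almost everywhere with some measurable function. -/
def UniversallyMeasurableFn {X : Type*} [MeasurableSpace X] (h : X → ℝ) : Prop :=
  ∀ μ' : Measure X, IsProbabilityMeasure μ' → ∃ g : X → ℝ, Measurable g ∧ h =ᵐ[μ'] g

open Filter Topology Set

section Hilbert

/-- A decreasing sequence of nonempty convex sets, the first of which is bounded, in an inner
product space admits a Cauchy selection. -/
lemma exists_cauchySeq_of_antitone_convex {H : Type*} [NormedAddCommGroup H]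
    [InnerProductSpace ℝ H] (C : ℕ → Set H) (hanti : Antitone C) (hconv : ∀ n, Convex ℝ (C n))
    (hne : ∀ n, (C n).Nonempty) (R : ℝ) (hR : ∀ x ∈ C 0, ‖x‖ ≤ R) :
    ∃ F : ℕ → H, (∀ n, F n ∈ C n) ∧ CauchySeq F := by
  set a : ℕ → ℝ := fun n => sInf (norm '' C n) with ha
  have hbdd : ∀ n, BddBelow (norm '' C n) := fun n =>
    ⟨0, by rintro _ ⟨x, -, rfl⟩; exact norm_nonneg x⟩
  have hle : ∀ n, ∀ x ∈ C n, a n ≤ ‖x‖ := fun n x hx => csInf_le (hbdd n) ⟨x, hx, rfl⟩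
  have ha0 : ∀ n, 0 ≤ a n := fun n => by
    apply le_csInf ((hne n).image _)
    rintro _ ⟨x, -, rfl⟩; exact norm_nonneg x
  have hamono : Monotone a := fun n k hnk =>
    csInf_le_csInf (hbdd n) ((hne k).image _) (image_mono (hanti hnk))
  have haR : ∀ n, a n ≤ R := fun n => by
    obtain ⟨x, hx⟩ := hne n
    exact (hle n x hx).trans (hR x (hanti (Nat.zero_le n) hx))
  have hab : BddAbove (range a) := ⟨R, by rintro _ ⟨n, rfl⟩; exact haR n⟩
  set L := ⨆ n, a n
  have haL : Tendsto a atTop (𝓝 L) := tendsto_atTop_ciSup hamono hab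
  have hL : ∀ n, a n ≤ L := le_ciSup hab
  have hex : ∀ n : ℕ, ∃ x ∈ C n, ‖x‖ < a n + 1 / ((n : ℝ) + 1) := fun n => by
    have hpos : (0 : ℝ) < 1 / ((n : ℝ) + 1) := by positivity
    obtain ⟨_, ⟨x, hx, rfl⟩, h⟩ := exists_lt_of_csInf_lt ((hne n).image norm)
      (lt_add_of_pos_right (a n) hpos)
    exact ⟨x, hx, h⟩
  choose F hF hFn using hex
  refine ⟨F, hF, ?_⟩
  set b : ℕ → ℝ := fun n => 4 * ((L + 1 / ((n : ℝ) + 1)) ^ 2 - a n ^ 2) with hb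
  have hb0 : Tendsto b atTop (𝓝 0) := by
    have h1 := ((tendsto_one_div_add_atTop_nhds_zero_nat (𝕜 := ℝ)).const_add L).pow 2
    have h2 := (h1.sub (haL.pow 2)).const_mul 4
    simpa [hb] using h2
  have hsq : ∀ n k, n ≤ k → ‖F n - F k‖ ^ 2 ≤ b n := fun n k hnk => by
    have hmid : (1 / 2 : ℝ) • F n + (1 / 2 : ℝ) • F k ∈ C n :=
      hconv n (hF n) (hanti hnk (hF k)) (by norm_num) (by norm_num) (by norm_num)
    have h1 := hle n _ hmid
    rw [← smul_add, norm_smul] at h1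
    norm_num at h1
    have h2 := parallelogram_law_with_norm ℝ (F n) (F k)
    have hδ : 1 / ((k : ℝ) + 1) ≤ 1 / ((n : ℝ) + 1) := by gcongr
    have h3 : ‖F n‖ ≤ L + 1 / ((n : ℝ) + 1) := (hFn n).le.trans (by linarith [hL n])
    have h4 : ‖F k‖ ≤ L + 1 / ((n : ℝ) + 1) := (hFn k).le.trans (by linarith [hL k])
    have h5 : (2 * a n) ^ 2 ≤ ‖F n + F k‖ ^ 2 := by
      have := ha0 n
      gcongr; linarith
    have h6 : ‖F n‖ ^ 2 ≤ (L + 1 / ((n : ℝ) + 1)) ^ 2 := by gcongr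
    have h7 : ‖F k‖ ^ 2 ≤ (L + 1 / ((n : ℝ) + 1)) ^ 2 := by gcongr
    simp only [hb]
    nlinarith
  have hb0' : Tendsto (fun n => √(b n)) atTop (𝓝 0) := by simpa using hb0.sqrt
  refine cauchySeq_of_le_tendsto_0' _ (fun n k hnk => ?_) hb0'
  rw [dist_eq_norm]
  exact Real.le_sqrt_of_sq_le (hsq n k hnk)

end Hilbert

section Limits

variable {Ω : Type*} [MeasurableSpace Ω]

/-- A Komlós-type selection: a decreasing sequence of nonempty convex sets of measurable
`[0,1]`-valued functions admits a selection that converges almost everywhere. -/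
lemma exists_ae_tendsto_of_antitone_convex (m : Measure Ω) [IsFiniteMeasure m]
    (C : ℕ → Set (Ω → ℝ)) (hanti : Antitone C) (hconv : ∀ n, Convex ℝ (C n))
    (hne : ∀ n, (C n).Nonempty) (hmeas : ∀ n, ∀ u ∈ C n, Measurable u)
    (hmem : ∀ n, ∀ u ∈ C n, ∀ ω, u ω ∈ Icc (0 : ℝ) 1) :
    ∃ (w : ℕ → Ω → ℝ) (u : Ω → ℝ), (∀ n, w n ∈ C n) ∧
      ∀ᵐ ω ∂m, Tendsto (fun n => w n ω) atTop (𝓝 (u ω)) := by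
  have hbd : ∀ n, ∀ u ∈ C n, ∀ᵐ ω ∂m, ‖u ω‖ ≤ 1 := fun n u hu => .of_forall fun ω => by
    rw [Real.norm_eq_abs, abs_of_nonneg (hmem n u hu ω).1]; exact (hmem n u hu ω).2
  have hLp : ∀ n, ∀ u ∈ C n, MemLp u 2 m := fun n u hu =>
    MemLp.of_bound (hmeas n u hu).aestronglyMeasurable 1 (hbd n u hu)
  let D : ℕ → Set (Lp ℝ 2 m) := fun n => {F | ∃ u ∈ C n, F =ᵐ[m] u}
  obtain ⟨F, hF, hFc⟩ := exists_cauchySeq_of_antitone_convex D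
    (fun n k hnk F ⟨u, hu, h⟩ => ⟨u, hanti hnk hu, h⟩)
    (fun n F ⟨u, hu, hFu⟩ G ⟨v, hv, hGv⟩ s t hs ht hst => by
      refine ⟨s • u + t • v, hconv n hu hv hs ht hst, ?_⟩
      refine (Lp.coeFn_add _ _).trans ?_
      exact ((Lp.coeFn_smul s F).trans (hFu.const_smul s)).add
        ((Lp.coeFn_smul t G).trans (hGv.const_smul t)))
    (fun n => by
      obtain ⟨u, hu⟩ := hne n
      exact ⟨(hLp n u hu).toLp u, u, hu, MemLp.coeFn_toLp _⟩)
    (measureUnivNNReal m ^ (2 : ENNReal).toReal⁻¹ * 1)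
    (fun F ⟨u, hu, hFu⟩ => by
      apply Lp.norm_le_of_ae_bound zero_le_one
      filter_upwards [hFu, hbd 0 u hu] with ω h1 h2
      rwa [h1])
  obtain ⟨G, hG⟩ := cauchySeq_tendsto_of_complete hFc
  obtain ⟨φ, hφ, hlim⟩ := (tendstoInMeasure_of_tendsto_Lp hG).exists_seq_tendsto_ae
  choose v hv hFv using hF
  refine ⟨fun n => v (φ n), G, fun n => hanti (hφ.id_le n) (hv _), ?_⟩
  filter_upwards [hlim, ae_all_iff.2 fun n => hFv (φ n)] with ω h1 h2
  simpa only [h2] using h1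

/-- The measurable `[0,1]`-valued functions `u` with `t b ≤ u (x b) + u (y b)` for all `b ∈ B`. -/
def coverSet {I : Type*} (x y : I → Ω) (t : I → ℝ) (B : Set I) : Set (Ω → ℝ) :=
  {u | Measurable u ∧ (∀ ω, u ω ∈ Icc (0 : ℝ) 1) ∧ ∀ b ∈ B, t b ≤ u (x b) + u (y b)}

lemma integrable_of_mem_coverSet {I : Type*} {x y : I → Ω} {t : I → ℝ} {B : Set I}
    (m : Measure Ω) [IsFiniteMeasure m] {u : Ω → ℝ} (hu : u ∈ coverSet x y t B) :
    Integrable u m :=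
  Integrable.of_mem_Icc 0 1 hu.1.aemeasurable (.of_forall hu.2.1)

/-- The optimal cost of a cover is continuous along increasing sequences of sets. -/
lemma exists_mem_coverSet_iUnion {I : Type*} {x y : I → Ω} {t : I → ℝ} (ht : ∀ b, t b ≤ 1)
    (m : Measure Ω) [IsFiniteMeasure m] {B : ℕ → Set I} (hB : Monotone B) {α : ℝ}
    (h : ∀ n, ∃ u ∈ coverSet x y t (B n), ∫ ω, u ω ∂m ≤ α) :
    ∃ u ∈ coverSet x y t (⋃ n, B n), ∫ ω, u ω ∂m ≤ α := by
  obtain ⟨w, u, hw, hlim⟩ := exists_ae_tendsto_of_antitone_convex m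
    (fun n => {u | u ∈ coverSet x y t (B n) ∧ ∫ ω, u ω ∂m ≤ α})
    (fun n k hnk u hu => ⟨⟨hu.1.1, hu.1.2.1, fun b hb => hu.1.2.2 b (hB hnk hb)⟩, hu.2⟩)
    (fun n u hu v hv r s hr hs hrs => by
      refine ⟨⟨(hu.1.1.const_smul r).add (hv.1.1.const_smul s), fun ω => ?_, fun b hb => ?_⟩, ?_⟩
      · exact (convex_Icc (0 : ℝ) 1) (hu.1.2.1 ω) (hv.1.2.1 ω) hr hs hrs
      · have h1 := hu.1.2.2 b hb
        have h2 := hv.1.2.2 b hb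
        simp only [Pi.add_apply, Pi.smul_apply, smul_eq_mul]
        have : t b = r * t b + s * t b := by rw [← add_mul, hrs, one_mul]
        nlinarith [mul_le_mul_of_nonneg_left h1 hr, mul_le_mul_of_nonneg_left h2 hs]
      · have hi := integrable_of_mem_coverSet m hu.1
        have hj := integrable_of_mem_coverSet m hv.1
        simp only [Pi.add_apply, Pi.smul_apply, smul_eq_mul]
        rw [integral_add (hi.const_mul r) (hj.const_mul s), integral_const_mul,
          integral_const_mul]
        have : α = r * α + s * α := by rw [← add_mul, hrs, one_mul]
        nlinarith [mul_le_mul_of_nonneg_left hu.2 hr, mul_le_mul_of_nonneg_left hv.2 hs])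
    (fun n => by obtain ⟨u, hu, hu'⟩ := h n; exact ⟨u, hu, hu'⟩)
    (fun n u hu => hu.1.1) (fun n u hu => hu.1.2.1)
  obtain ⟨N, hN, hNm, hN0⟩ := exists_measurable_superset_of_null (ae_iff.1 hlim)
  have hNlim : ∀ ω ∉ N, Tendsto (fun n => w n ω) atTop (𝓝 (u ω)) := fun ω hω => by
    by_contra hc; exact hω (hN hc)
  classical
  let w' : ℕ → Ω → ℝ := fun n => N.piecewise 1 (w n)
  let u' : Ω → ℝ := N.piecewise 1 u
  have hw'm : ∀ n, Measurable (w' n) := fun n =>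
    Measurable.piecewise hNm measurable_const (hw n).1.1
  have hlim' : ∀ ω, Tendsto (fun n => w' n ω) atTop (𝓝 (u' ω)) := fun ω => by
    by_cases hω : ω ∈ N
    · simp [w', u', hω]
    · simpa [w', u', hω] using hNlim ω hω
  have hw'mem : ∀ n ω, w' n ω ∈ Icc (0 : ℝ) 1 := fun n ω => by
    by_cases hω : ω ∈ N
    · simp [w', hω]
    · simpa [w', hω] using (hw n).1.2.1 ω
  have hu'mem : ∀ ω, u' ω ∈ Icc (0 : ℝ) 1 := fun ω =>
    isClosed_Icc.mem_of_tendsto (hlim' ω) (.of_forall fun n => hw'mem n ω)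
  refine ⟨u', ⟨measurable_of_tendsto_metrizable hw'm (tendsto_pi_nhds.2 hlim'), hu'mem,
    fun b hb => ?_⟩, ?_⟩
  · by_cases hx : x b ∈ N
    · have : u' (x b) = 1 := by simp [u', hx]
      linarith [ht b, (hu'mem (y b)).1]
    by_cases hy : y b ∈ N
    · have : u' (y b) = 1 := by simp [u', hy]
      linarith [ht b, (hu'mem (x b)).1]
    obtain ⟨n, hn⟩ := mem_iUnion.1 hb
    refine ge_of_tendsto ((hlim' (x b)).add (hlim' (y b))) ?_
    filter_upwards [eventually_ge_atTop n] with k hk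
    simpa [w', hx, hy] using (hw k).1.2.2 b (hB hk hn)
  · have hint : Tendsto (fun n => ∫ ω, w' n ω ∂m) atTop (𝓝 (∫ ω, u' ω ∂m)) :=
      tendsto_integral_of_dominated_convergence (fun _ => 1)
        (fun n => (hw'm n).aestronglyMeasurable) (integrable_const _)
        (fun n => .of_forall fun ω => by
          rw [Real.norm_eq_abs, abs_of_nonneg (hw'mem n ω).1]; exact (hw'mem n ω).2)
        (.of_forall hlim')
    refine le_of_tendsto hint (.of_forall fun n => ?_)
    have hae : w' n =ᵐ[m] w n := by
      filter_upwards [compl_mem_ae_iff.2 hN0] with ω hω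
      simp [w', notMem_of_mem_compl hω]
    rw [integral_congr_ae hae]
    exact (hw n).2

end Limits

section Baire

/-- If `P` survives bounding one coordinate after another, then it holds on all the initial
stages of a compact box. -/
lemma exists_box_of_forall_exists_le (P : Set (ℕ → ℕ) → Prop) (h0 : P univ)
    (hP : ∀ B k, P B → ∃ n, P (B ∩ {b | b k ≤ n})) :
    ∃ N : ℕ → ℕ, ∀ k, P {b | ∀ i < k, b i ≤ N i} := by
  choose! n hn using hP
  let B : ℕ → Set (ℕ → ℕ) := fun k => Nat.rec univ (fun k B => B ∩ {b | b k ≤ n B k}) k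
  have hB : ∀ k, P (B k) := fun k => by
    induction k with
    | zero => exact h0
    | succ k ih => exact hn _ _ ih
  have hBeq : ∀ k, B k = {b | ∀ i < k, b i ≤ n (B i) i} := fun k => by
    induction k with
    | zero => simp [B]
    | succ k ih =>
      have : B (k + 1) = B k ∩ {b | b k ≤ n (B k) k} := rfl
      rw [this]
      nth_rewrite 1 [ih]
      ext b
      simp only [mem_inter_iff, mem_ofPred_eq, Nat.lt_succ_iff_lt_or_eq]
      constructor
      · rintro ⟨h1, h2⟩ i (hi | rfl)
        exacts [h1 i hi, h2]
      · exact fun h => ⟨fun i hi => h i (.inl hi), h k (.inr rfl)⟩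
  exact ⟨fun i => n (B i) i, fun k => hBeq k ▸ hB k⟩

lemma exists_subseq_tendsto_of_box (N : ℕ → ℕ) (b : ℕ → ℕ → ℕ)
    (hb : ∀ k, ∀ i < k, b k i ≤ N i) :
    ∃ (a : ℕ → ℕ) (φ : ℕ → ℕ), StrictMono φ ∧ Tendsto (b ∘ φ) atTop (𝓝 a) := by
  let M : ℕ → ℕ := fun i => N i + ∑ k ∈ Finset.range (i + 1), b k i
  have hM : ∀ k, b k ∈ Set.pi univ fun i => Iic (M i) := fun k i _ => by
    rcases lt_or_ge i k with h | h
    · exact (hb k i h).trans (Nat.le_add_right _ _)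
    · exact (Finset.single_le_sum (f := fun k => b k i) (fun _ _ => Nat.zero_le _)
        (Finset.mem_range.2 (Nat.lt_succ_of_le h))).trans (Nat.le_add_left _ _)
  have hK : IsCompact (Set.pi univ fun i => Iic (M i)) :=
    isCompact_univ_pi fun i => (finite_Iic (M i)).isCompact
  obtain ⟨a, -, φ, hφ, h⟩ := hK.tendsto_subseq hM
  exact ⟨a, φ, hφ, h⟩

lemma iUnion_inter_coord_le (B : Set (ℕ → ℕ)) (k : ℕ) :
    ⋃ n, B ∩ {b | b k ≤ n} = B := by
  ext b
  simp only [mem_iUnion, mem_inter_iff, mem_ofPred_eq, exists_and_left, and_iff_left_iff_imp]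
  exact fun _ => ⟨b k, le_rfl⟩

lemma monotone_inter_coord_le (B : Set (ℕ → ℕ)) (k : ℕ) :
    Monotone fun n => B ∩ {b | b k ≤ n} :=
  fun _ _ h => inter_subset_inter_right _ fun _ hb => le_trans hb h

/-- Analytic sets are measurable with respect to the completion of every finite measure. -/
theorem analyticSet_nullMeasurableSet {X : Type*} [MetricSpace X] [MeasurableSpace X]
    [BorelSpace X] (μ : Measure X) [IsFiniteMeasure μ] {s : Set X} (hs : AnalyticSet s) :
    NullMeasurableSet s μ := by
  rw [AnalyticSet] at hs
  obtain rfl | ⟨φ, hφ, rfl⟩ := hs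
  · exact .empty
  have key : ∀ c < μ (range φ), ∃ T ⊆ range φ, MeasurableSet T ∧ c ≤ μ T := fun c hc => by
    obtain ⟨N, hN⟩ := exists_box_of_forall_exists_le (fun B => c < μ (φ '' B))
      (by rwa [image_univ]) (fun B k hB => by
        rw [← iUnion_inter_coord_le B k, image_iUnion, Monotone.measure_iUnion
          fun _ _ h => image_mono (monotone_inter_coord_le B k h)] at hB
        exact lt_iSup_iff.1 hB)
    let V : ℕ → Set X := fun k => closure (φ '' {b | ∀ i < k, b i ≤ N i})
    have hVanti : Antitone V := fun k l hkl =>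
      closure_mono (image_mono fun b hb i hi => hb i (hi.trans_le hkl))
    refine ⟨⋂ k, V k, fun z hz => ?_, (isClosed_iInter fun k => isClosed_closure).measurableSet,
      ?_⟩
    · have hex : ∀ k : ℕ, ∃ b : ℕ → ℕ, (∀ i < k, b i ≤ N i) ∧
          dist z (φ b) < 1 / ((k : ℝ) + 1) := fun k => by
        obtain ⟨_, ⟨b, hb, rfl⟩, h⟩ :=
          Metric.mem_closure_iff.1 (mem_iInter.1 hz k) (1 / ((k : ℝ) + 1)) (by positivity)
        exact ⟨b, hb, h⟩
      choose b hb hbz using hex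
      obtain ⟨a, ψ, hψ, hlim⟩ := exists_subseq_tendsto_of_box N b hb
      refine ⟨a, tendsto_nhds_unique ((hφ.tendsto a).comp hlim) ?_⟩
      have hz : Tendsto (fun k => φ (b k)) atTop (𝓝 z) := by
        rw [tendsto_iff_dist_tendsto_zero]
        refine squeeze_zero (fun _ => dist_nonneg) (fun k => ?_)
          (tendsto_one_div_add_atTop_nhds_zero_nat (𝕜 := ℝ))
        rw [dist_comm]; exact (hbz k).le
      exact hz.comp hψ.tendsto_atTop
    · refine ge_of_tendsto (tendsto_measure_iInter_atTop
        (fun k => isClosed_closure.measurableSet.nullMeasurableSet) hVanti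
        ⟨0, measure_ne_top μ _⟩) (.of_forall fun k => ?_)
      exact (hN k).le.trans (measure_mono subset_closure)
  rcases eq_or_ne (μ (range φ)) 0 with h0 | h0
  · exact .of_null h0
  obtain ⟨c, -, hc, hclim⟩ := exists_seq_strictMono_tendsto' (pos_iff_ne_zero.2 h0)
  choose! T hT hTm hcT using key
  have hTU : ⋃ n, T (c n) ⊆ range φ := iUnion_subset fun n => hT _ (hc n).2
  have hTUm : MeasurableSet (⋃ n, T (c n)) := .iUnion fun n => hTm _ (hc n).2
  have hle : μ (range φ) ≤ μ (⋃ n, T (c n)) := le_of_tendsto hclim (.of_forall fun n =>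
    (hcT _ (hc n).2).trans (measure_mono (subset_iUnion (fun n => T (c n)) n)))
  exact hTUm.nullMeasurableSet.congr
    (ae_eq_of_subset_of_measure_ge hTU hle hTUm.nullMeasurableSet (measure_ne_top μ _))

/-- The infimum over one variable of a measurable function of two variables is universally
measurable. -/
theorem universallyMeasurableFn_iInf {X : Type*} [MeasurableSpace X] [StandardBorelSpace X]
    {c : X × X → ℝ} (hc : Measurable c) (h0 : ∀ q, 0 ≤ c q) :
    UniversallyMeasurableFn fun x => ⨅ y, c (x, y) := by
  intro μ' _
  let := upgradeStandardBorel X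
  let := TopologicalSpace.upgradeIsCompletelyMetrizable X
  have hnull : NullMeasurable (fun x => ⨅ y, c (x, y)) μ' := by
    refine measurable_of_Iio (α := ℝ) (δ := NullMeasurableSpace X μ') fun a => ?_
    have : (fun x => ⨅ y, c (x, y)) ⁻¹' Iio a = Prod.fst '' {q | c q < a} := by
      ext x
      have hne : Nonempty X := ⟨x⟩
      have hbdd : BddBelow (range fun y => c (x, y)) := ⟨0, by rintro _ ⟨y, rfl⟩; exact h0 _⟩
      simp [ciInf_lt_iff hbdd]
    change NullMeasurableSet ((fun x => ⨅ y, c (x, y)) ⁻¹' Iio a) μ'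
    rw [this]
    exact analyticSet_nullMeasurableSet μ'
      ((measurableSet_lt hc measurable_const).analyticSet_image measurable_fst)
  obtain ⟨g, hg, h⟩ := hnull.aemeasurable
  exact ⟨g, hg, h⟩

end Baire

section Coupling

variable {X : Type*} [MeasurableSpace X]

lemma integrable_of_measurable_of_abs_le (μ : Measure X) [IsFiniteMeasure μ] {f : X → ℝ}
    (hf : Measurable f) {M : ℝ} (hM : ∀ x, |f x| ≤ M) : Integrable f μ :=
  .of_bound hf.aestronglyMeasurable M (.of_forall hM)

/-- A positive linear functional on `C(Z, ℝ)`, for `Z` compact metric, that maps `1` to `1` is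
integration against a probability measure. -/
lemma exists_isProbabilityMeasure_integral_eq {Z : Type*} [MetricSpace Z] [CompactSpace Z]
    [MeasurableSpace Z] [BorelSpace Z] (Λ : C(Z, ℝ) →ₗ[ℝ] ℝ)
    (hpos : ∀ c : C(Z, ℝ), (∀ z, 0 ≤ c z) → 0 ≤ Λ c) (hone : Λ 1 = 1) :
    ∃ κ : Measure Z, IsProbabilityMeasure κ ∧ ∀ c : C(Z, ℝ), ∫ z, c z ∂κ = Λ c := by
  let Λ' : CompactlySupportedContinuousMap Z ℝ →ₚ[ℝ] ℝ :=
  { toFun g := Λ g.toContinuousMap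
    map_add' g g' := Λ.map_add g.toContinuousMap g'.toContinuousMap
    map_smul' c g := Λ.map_smul c g.toContinuousMap
    monotone' g g' hgg' := by
      have h := hpos (g'.toContinuousMap - g.toContinuousMap) fun z => sub_nonneg.2 (hgg' z)
      rw [map_sub] at h
      exact sub_nonneg.1 h }
  have hint : ∀ c : C(Z, ℝ), ∫ z, c z ∂(RealRMK.rieszMeasure Λ') = Λ c := fun c => by
    let c' : CompactlySupportedContinuousMap Z ℝ :=
    { toFun := c
      hasCompactSupport' := HasCompactSupport.of_compactSpace _ }
    exact RealRMK.integral_rieszMeasure Λ' c'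
  refine ⟨RealRMK.rieszMeasure Λ', ⟨?_⟩, hint⟩
  have h1 := hint 1
  rw [hone] at h1
  simpa [measureReal_def, ENNReal.toReal_eq_one_iff] using h1

lemma integral_mul_sub_integral_add [TopologicalSpace X] [CompactSpace X] [BorelSpace X]
    (ρ : Measure X) [IsProbabilityMeasure ρ] (φ : C(X, ℝ)) (s α : ℝ) :
    ∫ x, (s * (φ x - ∫ x', φ x' ∂ρ) + α) ∂ρ = α := by
  have hi : Integrable (fun x => φ x) ρ := integrable_of_measurable_of_abs_le ρ
    φ.continuous.measurable (fun x => φ.norm_coe_le_norm x)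
  have hj : Integrable (fun x => φ x - ∫ x', φ x' ∂ρ) ρ := hi.sub (integrable_const _)
  rw [integral_add (hj.const_mul s) (integrable_const _), integral_const_mul,
    integral_sub hi (integrable_const _)]
  simp

/-- Hahn–Banach step of the duality for a decreasing sequence of continuous functions. -/
theorem exists_isCoupling_of_antitone [MetricSpace X] [CompactSpace X] [BorelSpace X]
    (μ ν : Measure X) [IsProbabilityMeasure μ] [IsProbabilityMeasure ν]
    (c : ℕ → C(X × X, ℝ)) (hanti : Antitone c) (α : ℝ)
    (hα : ∀ k, ∀ f g : X → ℝ, Measurable f → Measurable g → (∃ M, ∀ x, |f x| ≤ M) →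
      (∃ M, ∀ x, |g x| ≤ M) → (∀ x y, c k (x, y) ≤ f x + g y) →
      α < ∫ x, f x ∂μ + ∫ x, g x ∂ν) :
    ∃ κ : Measure (X × X), IsCoupling κ μ ν ∧ ∀ k, α ≤ ∫ q, c k q ∂κ := by
  let U : Set C(X × X, ℝ) := {e | ∃ f g : X → ℝ, Measurable f ∧ Measurable g ∧
    (∃ M, ∀ x, |f x| ≤ M) ∧ (∃ M, ∀ x, |g x| ≤ M) ∧ ∫ x, f x ∂μ + ∫ x, g x ∂ν ≤ α ∧
    ∃ δ > 0, ∀ x y, e (x, y) + δ ≤ f x + g y}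
  let F : Set C(X × X, ℝ) := {e | ∃ k, ∀ q, c k q ≤ e q}
  have hUconv : Convex ℝ U := by
    rintro e ⟨f, g, hf, hg, ⟨M, hM⟩, ⟨M', hM'⟩, hint, δ, hδ, hle⟩ e₂
      ⟨f₂, g₂, hf₂, hg₂, ⟨M₂, hM₂⟩, ⟨M₂', hM₂'⟩, hint₂, δ₂, hδ₂, hle₂⟩ r s hr hs hrs
    have habs : ∀ a b A B : ℝ, |a| ≤ A → |b| ≤ B → |r * a + s * b| ≤ r * A + s * B :=
      fun a b A B ha hb => by
        refine (abs_add_le _ _).trans ?_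
        rw [abs_mul, abs_mul, abs_of_nonneg hr, abs_of_nonneg hs]
        gcongr
    refine ⟨fun x => r * f x + s * f₂ x, fun x => r * g x + s * g₂ x, by fun_prop, by fun_prop,
      ⟨_, fun x => habs _ _ _ _ (hM x) (hM₂ x)⟩, ⟨_, fun x => habs _ _ _ _ (hM' x) (hM₂' x)⟩,
      ?_, min δ δ₂, lt_min hδ hδ₂, fun x y => ?_⟩
    · have i1 := integrable_of_measurable_of_abs_le μ hf hM
      have i2 := integrable_of_measurable_of_abs_le μ hf₂ hM₂
      have i3 := integrable_of_measurable_of_abs_le ν hg hM'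
      have i4 := integrable_of_measurable_of_abs_le ν hg₂ hM₂'
      rw [integral_add (i1.const_mul r) (i2.const_mul s),
        integral_add (i3.const_mul r) (i4.const_mul s)]
      simp only [integral_const_mul]
      have : α = r * α + s * α := by rw [← add_mul, hrs, one_mul]
      nlinarith [mul_le_mul_of_nonneg_left hint hr, mul_le_mul_of_nonneg_left hint₂ hs]
    · have h1 := mul_le_mul_of_nonneg_left (hle x y) hr
      have h2 := mul_le_mul_of_nonneg_left (hle₂ x y) hs
      have h3 := mul_le_mul_of_nonneg_left (min_le_left δ δ₂) hr
      have h4 := mul_le_mul_of_nonneg_left (min_le_right δ δ₂) hs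
      have h5 : min δ δ₂ = r * min δ δ₂ + s * min δ δ₂ := by rw [← add_mul, hrs, one_mul]
      simp only [ContinuousMap.add_apply, ContinuousMap.smul_apply, smul_eq_mul]
      linarith
  have hUopen : IsOpen U := by
    rw [Metric.isOpen_iff]
    rintro e ⟨f, g, hf, hg, hM, hM', hint, δ, hδ, hle⟩
    refine ⟨δ / 2, half_pos hδ, fun e₂ he₂ =>
      ⟨f, g, hf, hg, hM, hM', hint, δ / 2, half_pos hδ, fun x y => ?_⟩⟩
    have h1 := (ContinuousMap.dist_apply_le_dist (f := e₂) (g := e) (x, y)).trans_lt he₂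
    rw [Real.dist_eq] at h1
    linarith [hle x y, (abs_lt.1 h1).2]
  have hFconv : Convex ℝ F := by
    rintro e ⟨k, hk⟩ e₂ ⟨k₂, hk₂⟩ r s hr hs hrs
    refine ⟨max k k₂, fun q => ?_⟩
    have hmax₁ : ∀ q, c (max k k₂) q ≤ c k q := hanti (le_max_left k k₂)
    have hmax₂ : ∀ q, c (max k k₂) q ≤ c k₂ q := hanti (le_max_right k k₂)
    have h1 := mul_le_mul_of_nonneg_left ((hmax₁ q).trans (hk q)) hr
    have h2 := mul_le_mul_of_nonneg_left ((hmax₂ q).trans (hk₂ q)) hs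
    have h3 : c (max k k₂) q = r * c (max k k₂) q + s * c (max k k₂) q := by
      rw [← add_mul, hrs, one_mul]
    simp only [ContinuousMap.add_apply, ContinuousMap.smul_apply, smul_eq_mul]
    linarith
  have hdisj : Disjoint U F := by
    rw [Set.disjoint_left]
    rintro e ⟨f, g, hf, hg, hM, hM', hint, δ, hδ, hle⟩ ⟨k, hk⟩
    exact (hα k f g hf hg hM hM' fun x y => by linarith [hk (x, y), hle x y]).not_ge hint
  obtain ⟨Λ, r, hΛU, hΛF⟩ := geometric_hahn_banach_open hUconv hUopen hFconv hdisj
  have hpos : ∀ e : C(X × X, ℝ), (∀ q, 0 ≤ e q) → 0 ≤ Λ e := fun e he => by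
    by_contra! hneg
    have hs : ∀ s : ℝ, 0 ≤ s → r ≤ Λ (c 0) + s * Λ e := fun s hs => by
      have h := hΛF (c 0 + s • e) ⟨0, fun q => by
        simpa using mul_nonneg hs (he q)⟩
      simpa using h
    have h0 : r ≤ Λ (c 0) := by simpa using hs 0 le_rfl
    have h1 := hs ((Λ (c 0) - r + 1) / (-Λ e)) (div_nonneg (by linarith) (by linarith))
    have h2 : (Λ (c 0) - r + 1) / (-Λ e) * Λ e = -(Λ (c 0) - r + 1) := by
      rw [div_neg, neg_mul, div_mul_cancel₀ _ hneg.ne]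
    linarith
  have hmono : ∀ e e₂ : C(X × X, ℝ), (∀ q, e q ≤ e₂ q) → Λ e ≤ Λ e₂ := fun e e₂ h => by
    have := hpos (e₂ - e) fun q => sub_nonneg.2 (h q)
    rw [map_sub] at this
    linarith
  have hbound : ∀ e : C(X × X, ℝ), Λ e ≤ ‖e‖ * Λ 1 := fun e => by
    have h := hmono e (‖e‖ • (1 : C(X × X, ℝ))) fun q => by
      simpa using (le_abs_self _).trans (e.norm_coe_le_norm q)
    simpa using h
  have hone : 0 < Λ 1 := by
    refine (hpos 1 fun _ => zero_le_one).lt_of_ne fun h0 => ?_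
    have hz : ∀ e, Λ e = 0 := fun e => by
      have h1 := hbound e
      have h2 := hbound (-e)
      rw [← h0, mul_zero] at h1 h2
      rw [map_neg] at h2
      linarith
    have h1 := hΛF (c 0) ⟨0, fun _ => le_rfl⟩
    have h2 := hΛU ((α - 1) • (1 : C(X × X, ℝ))) ⟨fun _ => α, fun _ => 0, measurable_const,
      measurable_const, ⟨|α|, fun _ => le_rfl⟩, ⟨0, by simp⟩, by simp, 1, one_pos,
      fun x y => by simp⟩
    rw [hz] at h1 h2
    linarith
  have hmarg : ∀ e : C(X × X, ℝ), (∀ s : ℝ, 0 ≤ s →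
      ∀ δ : ℝ, 0 < δ → s • e + (α - δ) • (1 : C(X × X, ℝ)) ∈ U) → Λ e ≤ 0 := fun e he => by
    by_contra! hneg
    have hs : ∀ s : ℝ, 0 ≤ s → s * Λ e + (α - 1) * Λ 1 < r := fun s hs => by
      simpa using hΛU _ (he s hs 1 one_pos)
    have h0 := hs 0 le_rfl
    have h1 := hs ((r - (α - 1) * Λ 1) / Λ e) (div_nonneg (by linarith) hneg.le)
    rw [div_mul_cancel₀ _ hneg.ne'] at h1
    linarith
  have hfst : ∀ φ : C(X, ℝ), Λ (φ.comp ContinuousMap.fst) ≤ (∫ x, φ x ∂μ) * Λ 1 := fun φ => by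
    have h := hmarg (φ.comp ContinuousMap.fst - (∫ x, φ x ∂μ) • 1) fun s hs δ hδ => by
      have hb := fun x => ContinuousMap.norm_coe_le_norm
          (s • (φ - ContinuousMap.const X (∫ x, φ x ∂μ)) + ContinuousMap.const X α) x
      refine ⟨fun x => s * (φ x - ∫ x, φ x ∂μ) + α, fun _ => 0,
        by have := φ.continuous.measurable; fun_prop, measurable_const, ⟨_, hb⟩, ⟨0, by simp⟩,
        by simp [integral_mul_sub_integral_add], δ, hδ,
        fun x y => by simp; linarith⟩
    rw [map_sub, map_smul, smul_eq_mul] at h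
    linarith
  have hsnd : ∀ φ : C(X, ℝ), Λ (φ.comp ContinuousMap.snd) ≤ (∫ x, φ x ∂ν) * Λ 1 := fun φ => by
    have h := hmarg (φ.comp ContinuousMap.snd - (∫ x, φ x ∂ν) • 1) fun s hs δ hδ => by
      have hb := fun x => ContinuousMap.norm_coe_le_norm
          (s • (φ - ContinuousMap.const X (∫ x, φ x ∂ν)) + ContinuousMap.const X α) x
      refine ⟨fun _ => 0, fun x => s * (φ x - ∫ x, φ x ∂ν) + α, measurable_const,
        by have := φ.continuous.measurable; fun_prop, ⟨0, by simp⟩, ⟨_, hb⟩,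
        by simp [integral_mul_sub_integral_add], δ, hδ,
        fun x y => by simp; linarith⟩
    rw [map_sub, map_smul, smul_eq_mul] at h
    linarith
  have hαr : α * Λ 1 ≤ r := by
    refine le_of_forall_pos_lt_add fun ε hε => ?_
    have h := hΛU ((α - ε / Λ 1) • (1 : C(X × X, ℝ))) ⟨fun _ => α, fun _ => 0, measurable_const,
      measurable_const, ⟨|α|, fun _ => le_rfl⟩, ⟨0, by simp⟩, by simp, ε / Λ 1,
      div_pos hε hone, fun x y => by simp⟩
    rw [map_smul, smul_eq_mul, sub_mul, div_mul_cancel₀ _ hone.ne'] at h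
    linarith
  obtain ⟨κ, hκ, hκint⟩ := exists_isProbabilityMeasure_integral_eq
    ((Λ 1)⁻¹ • (Λ : C(X × X, ℝ) →ₗ[ℝ] ℝ))
    (fun e he => by simpa using mul_nonneg (inv_nonneg.2 hone.le) (hpos e he))
    (by simp [hone.ne'])
  have hκint' : ∀ e : C(X × X, ℝ), ∫ q, e q ∂κ = (Λ 1)⁻¹ * Λ e := fun e => by
    rw [hκint]; rfl
  have hmap : ∀ (ρ : Measure X) [IsProbabilityMeasure ρ] (π : C(X × X, X)),
      (∀ φ : C(X, ℝ), Λ (φ.comp π) ≤ (∫ x, φ x ∂ρ) * Λ 1) → κ.map π = ρ := fun ρ _ π h => by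
    have hπ : Measurable π := π.continuous.measurable
    have := Measure.isProbabilityMeasure_map (μ := κ) hπ.aemeasurable
    refine ext_of_forall_integral_eq_of_IsFiniteMeasure fun φ => ?_
    have hle : ∀ φ : C(X, ℝ), ∫ x, φ x ∂(κ.map π) ≤ ∫ x, φ x ∂ρ := fun φ => by
      rw [integral_map hπ.aemeasurable φ.continuous.measurable.aestronglyMeasurable]
      have h1 := hκint' (φ.comp π)
      simp only [ContinuousMap.comp_apply] at h1
      rw [h1, inv_mul_le_iff₀ hone, mul_comm]
      exact h φ
    refine le_antisymm (hle φ.toContinuousMap) ?_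
    have h2 := hle (-φ.toContinuousMap)
    simp only [ContinuousMap.neg_apply, integral_neg] at h2
    exact neg_le_neg_iff.1 h2
  refine ⟨κ, ⟨hκ, hmap μ ContinuousMap.fst hfst, hmap ν ContinuousMap.snd hsnd⟩, fun k => ?_⟩
  rw [hκint', inv_mul_eq_div, le_div_iff₀ hone]
  exact hαr.trans (hΛF (c k) ⟨k, fun _ => le_rfl⟩)

end Coupling

section Duality

/-- The Lipschitz regularization of slope `r` of the function `z b ↦ t b`, `b ∈ B`. -/
noncomputable def lipschitzHull {I Z : Type*} [PseudoMetricSpace Z] (z : I → Z) (t : I → ℝ)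
    (B : Set I) (r : ℝ) (q : Z) : ℝ :=
  ⨆ b : B, max 0 (t b - r * dist q (z b))

variable {I Z : Type*} [PseudoMetricSpace Z] {z : I → Z} {t : I → ℝ} {B : Set I} {r : ℝ}

lemma lipschitzHull_nonneg (q : Z) : 0 ≤ lipschitzHull z t B r q :=
  Real.iSup_nonneg fun _ => le_max_left _ _

lemma max_sub_mul_dist_le_one (ht : ∀ b, t b ≤ 1) (hr : 0 ≤ r) (q : Z) (b : I) :
    max 0 (t b - r * dist q (z b)) ≤ 1 :=
  max_le zero_le_one (by linarith [ht b, mul_nonneg hr (dist_nonneg (x := q) (y := z b))])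

lemma lipschitzHull_le_one (ht : ∀ b, t b ≤ 1) (hr : 0 ≤ r) (q : Z) :
    lipschitzHull z t B r q ≤ 1 :=
  Real.iSup_le (fun b => max_sub_mul_dist_le_one ht hr q b) zero_le_one

lemma le_lipschitzHull (ht : ∀ b, t b ≤ 1) (hr : 0 ≤ r) (q : Z) {b : I} (hb : b ∈ B) :
    max 0 (t b - r * dist q (z b)) ≤ lipschitzHull z t B r q :=
  le_ciSup (f := fun b : B => max 0 (t b - r * dist q (z b)))
    ⟨1, by rintro _ ⟨b, rfl⟩; exact max_sub_mul_dist_le_one ht hr q b⟩ ⟨b, hb⟩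

lemma apply_le_lipschitzHull (ht : ∀ b, t b ≤ 1) (hr : 0 ≤ r) {b : I} (hb : b ∈ B) :
    t b ≤ lipschitzHull z t B r (z b) := by
  have h := le_lipschitzHull (z := z) ht hr (z b) hb
  rw [dist_self, mul_zero, sub_zero] at h
  exact (le_max_right _ _).trans h

lemma continuous_lipschitzHull (ht : ∀ b, t b ≤ 1) (hr : 0 ≤ r) :
    Continuous (lipschitzHull z t B r) := by
  refine (LipschitzWith.of_le_add_mul r.toNNReal fun q q' => ?_).continuous
  rw [Real.coe_toNNReal r hr]
  have h0 := mul_nonneg hr (dist_nonneg (x := q) (y := q'))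
  refine Real.iSup_le (fun b => ?_) (add_nonneg (lipschitzHull_nonneg q') h0)
  have h1 := le_lipschitzHull (z := z) ht hr q' b.2
  have h2 := mul_le_mul_of_nonneg_left (dist_triangle q' q (z b)) hr
  rw [dist_comm q' q] at h2
  refine max_le (add_nonneg (lipschitzHull_nonneg q') h0) ?_
  linarith [(le_max_right _ _).trans h1]

lemma lipschitzHull_anti (ht : ∀ b, t b ≤ 1) {B' : Set I} {r' : ℝ} (hr : 0 ≤ r) (hrr' : r ≤ r')
    (hB : B' ⊆ B) (q : Z) : lipschitzHull z t B' r' q ≤ lipschitzHull z t B r q := by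
  refine Real.iSup_le (fun b => ?_) (lipschitzHull_nonneg q)
  refine le_trans (max_le_max_left 0 ?_) (le_lipschitzHull ht hr q (hB b.2))
  have := mul_le_mul_of_nonneg_right hrr' (dist_nonneg (x := q) (y := z b))
  linarith

lemma exists_of_lt_lipschitzHull {q : Z} {s : ℝ} (hs : 0 ≤ s)
    (h : s < lipschitzHull z t B r q) : ∃ b ∈ B, s < t b - r * dist q (z b) := by
  by_contra! hc
  exact h.not_ge (Real.iSup_le (fun b => max_le hs (hc b b.2)) hs)

/-- The regularizations over the initial stages of a compact box decrease below any function
whose hypograph contains the parametrized points. -/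
lemma iInf_lipschitzHull_le {Z : Type*} [MetricSpace Z] {z : (ℕ → ℕ) → Z} {t : (ℕ → ℕ) → ℝ}
    (hz : Continuous z) (htc : Continuous t) (ht : ∀ b, t b ≤ 1) {h : Z → ℝ}
    (h0 : ∀ q, 0 ≤ h q) (hth : ∀ b, t b ≤ h (z b)) (N : ℕ → ℕ) (q : Z) :
    ⨅ k : ℕ, lipschitzHull z t {b | ∀ i < k, b i ≤ N i} ((k : ℝ) + 1) q ≤ h q := by
  by_contra! hlt
  obtain ⟨s, hs, hs'⟩ := exists_between hlt
  have hs0 : 0 ≤ s := (h0 q).trans hs.le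
  have hex : ∀ k : ℕ, ∃ b ∈ {b : ℕ → ℕ | ∀ i < k, b i ≤ N i},
      s < t b - ((k : ℝ) + 1) * dist q (z b) := fun k =>
    exists_of_lt_lipschitzHull hs0 (hs'.trans_le (ciInf_le
      ⟨0, by rintro _ ⟨k, rfl⟩; exact lipschitzHull_nonneg q⟩ k))
  choose b hb hbs using hex
  obtain ⟨a, ψ, hψ, hlim⟩ := exists_subseq_tendsto_of_box N b hb
  have hzq : Tendsto (fun k => z (b k)) atTop (𝓝 q) := by
    rw [tendsto_iff_dist_tendsto_zero]
    refine squeeze_zero (fun _ => dist_nonneg) (fun k => ?_)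
      (tendsto_one_div_add_atTop_nhds_zero_nat (𝕜 := ℝ))
    rw [dist_comm, le_div_iff₀ (by positivity)]
    linarith [hbs k, ht (b k)]
  have hza : z a = q :=
    tendsto_nhds_unique ((hz.tendsto a).comp hlim) (hzq.comp hψ.tendsto_atTop)
  have hta : s ≤ t a := ge_of_tendsto ((htc.tendsto a).comp hlim) (.of_forall fun k => by
    have := mul_nonneg (by positivity : (0 : ℝ) ≤ (ψ k : ℝ) + 1)
      (dist_nonneg (x := q) (y := z (b (ψ k))))
    simp only [Function.comp_apply]
    linarith [hbs (ψ k)])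
  have := hth a
  rw [hza] at this
  linarith

variable {X : Type*} [MeasurableSpace X]

lemma integral_sumElim_measure (μ ν : Measure X) [IsFiniteMeasure μ] [IsFiniteMeasure ν]
    {u : X ⊕ X → ℝ} (hu : Measurable u) (hmem : ∀ ω, u ω ∈ Icc (0 : ℝ) 1) :
    ∫ ω, u ω ∂(μ.map Sum.inl + ν.map Sum.inr) =
      ∫ x, u (Sum.inl x) ∂μ + ∫ x, u (Sum.inr x) ∂ν := by
  rw [integral_add_measure (.of_mem_Icc 0 1 hu.aemeasurable (.of_forall hmem))
      (.of_mem_Icc 0 1 hu.aemeasurable (.of_forall hmem)),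
    integral_map measurable_inl.aemeasurable hu.aestronglyMeasurable,
    integral_map measurable_inr.aemeasurable hu.aestronglyMeasurable]

/-- A pair of bounded functions with `f x + g y ≥ 0` can be shifted and truncated to take values
in `[0,1]`, at no greater cost and without spoiling lower bounds by numbers at most `1`. -/
lemma exists_truncation (μ ν : Measure X) [IsProbabilityMeasure μ] [IsProbabilityMeasure ν]
    {f g : X → ℝ} (hf : Measurable f) (hg : Measurable g) (hfM : ∃ M, ∀ x, |f x| ≤ M)
    (hgM : ∃ M, ∀ x, |g x| ≤ M) (hfg : ∀ x y, 0 ≤ f x + g y) :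
    ∃ f' g' : X → ℝ, Measurable f' ∧ Measurable g' ∧ (∀ x, f' x ∈ Icc (0 : ℝ) 1) ∧
      (∀ x, g' x ∈ Icc (0 : ℝ) 1) ∧
      (∀ x y, ∀ s ≤ 1, s ≤ f x + g y → s ≤ f' x + g' y) ∧
      ∫ x, f' x ∂μ + ∫ x, g' x ∂ν ≤ ∫ x, f x ∂μ + ∫ x, g x ∂ν := by
  have hne : Nonempty X := nonempty_of_isProbabilityMeasure μ
  obtain ⟨M, hM⟩ := hfM
  obtain ⟨M', hM'⟩ := hgM
  set a := ⨅ x, f x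
  have hfa : ∀ x, 0 ≤ f x - a := fun x => sub_nonneg.2
    (ciInf_le ⟨-M, by rintro _ ⟨x, rfl⟩; exact (abs_le.1 (hM x)).1⟩ x)
  have hga : ∀ y, 0 ≤ g y + a := fun y => by
    have : -g y ≤ a := le_ciInf fun x => by linarith [hfg x y]
    linarith
  have hf' : Measurable fun x => min (f x - a) 1 := (hf.sub_const a).min measurable_const
  have hg' : Measurable fun x => min (g x + a) 1 := (hg.add_const a).min measurable_const
  have hfm : ∀ x, min (f x - a) 1 ∈ Icc (0 : ℝ) 1 := fun x =>
    ⟨le_min (hfa x) zero_le_one, min_le_right _ _⟩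
  have hgm : ∀ x, min (g x + a) 1 ∈ Icc (0 : ℝ) 1 := fun x =>
    ⟨le_min (hga x) zero_le_one, min_le_right _ _⟩
  refine ⟨fun x => min (f x - a) 1, fun x => min (g x + a) 1, hf', hg', hfm, hgm,
    fun x y s hs hsfg => ?_, ?_⟩
  · rcases le_total (f x - a) 1 with h1 | h1
    · rcases le_total (g y + a) 1 with h2 | h2
      · simp only [min_eq_left h1, min_eq_left h2]
        linarith
      · simp only [min_eq_right h2]
        linarith [(hfm x).1]
    · simp only [min_eq_right h1]
      linarith [(hgm y).1]
  · have i1 := integrable_of_measurable_of_abs_le μ hf hM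
    have i2 := integrable_of_measurable_of_abs_le ν hg hM'
    have h1 : ∫ x, min (f x - a) 1 ∂μ ≤ ∫ x, (f x - a) ∂μ :=
      integral_mono (.of_mem_Icc 0 1 hf'.aemeasurable (.of_forall hfm))
        (i1.sub (integrable_const a)) fun x => min_le_left _ _
    have h2 : ∫ x, min (g x + a) 1 ∂ν ≤ ∫ x, (g x + a) ∂ν :=
      integral_mono (.of_mem_Icc 0 1 hg'.aemeasurable (.of_forall hgm))
        (i2.add (integrable_const a)) fun x => min_le_left _ _
    rw [integral_sub i1 (integrable_const a)] at h1
    rw [integral_add i2 (integrable_const a)] at h2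
    simp only [integral_const, probReal_univ, one_smul] at h1 h2
    linarith

/-- Kellerer's duality for a measurable `[0,1]`-valued profit function on a compact metric
space. -/
theorem exists_isCoupling_le_integral_of_compactSpace [MetricSpace X] [CompactSpace X]
    [BorelSpace X] (μ ν : Measure X) [IsProbabilityMeasure μ] [IsProbabilityMeasure ν]
    {h : X × X → ℝ} (hh : Measurable h) (hmem : ∀ q, h q ∈ Icc (0 : ℝ) 1) (α : ℝ)
    (hα : ∀ f g : X → ℝ, Measurable f → Measurable g → (∀ x, f x ∈ Icc (0 : ℝ) 1) →
      (∀ x, g x ∈ Icc (0 : ℝ) 1) → (∀ x y, h (x, y) ≤ f x + g y) →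
      α < ∫ x, f x ∂μ + ∫ x, g x ∂ν) :
    ∃ κ : Measure (X × X), IsCoupling κ μ ν ∧ α ≤ ∫ q, h q ∂κ := by
  have hne : Nonempty X := nonempty_of_isProbabilityMeasure μ
  let A : Set ((X × X) × ℝ) := {p | 0 ≤ p.2 ∧ p.2 ≤ h p.1}
  have hA : MeasurableSet A :=
    (measurableSet_le measurable_const measurable_snd).inter
      (measurableSet_le measurable_snd (hh.comp measurable_fst))
  have hAan : AnalyticSet A := hA.analyticSet
  rw [AnalyticSet] at hAan
  obtain ⟨φ, hφ, hφA⟩ := hAan.resolve_left (Nonempty.ne_empty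
    ⟨(Classical.arbitrary _, 0), le_rfl, (hmem _).1⟩)
  have hφmem : ∀ b, 0 ≤ (φ b).2 ∧ (φ b).2 ≤ h (φ b).1 := fun b => by
    have : φ b ∈ A := hφA ▸ mem_range_self b
    exact this
  let z : (ℕ → ℕ) → X × X := fun b => (φ b).1
  let t : (ℕ → ℕ) → ℝ := fun b => (φ b).2
  have hz : Continuous z := continuous_fst.comp hφ
  have htc : Continuous t := continuous_snd.comp hφ
  have ht : ∀ b, t b ≤ 1 := fun b => (hφmem b).2.trans (hmem _).2
  let x : (ℕ → ℕ) → X ⊕ X := fun b => Sum.inl (z b).1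
  let y : (ℕ → ℕ) → X ⊕ X := fun b => Sum.inr (z b).2
  let m : Measure (X ⊕ X) := μ.map Sum.inl + ν.map Sum.inr
  obtain ⟨N, hN⟩ := exists_box_of_forall_exists_le
    (fun B => ∀ u ∈ coverSet x y t B, α < ∫ ω, u ω ∂m)
    (fun u hu => by
      rw [integral_sumElim_measure μ ν hu.1 hu.2.1]
      refine hα _ _ (hu.1.comp measurable_inl) (hu.1.comp measurable_inr) (fun _ => hu.2.1 _)
        (fun _ => hu.2.1 _) fun x' y' => ?_
      have hmemA : (((x', y'), h (x', y')) : (X × X) × ℝ) ∈ A := ⟨(hmem _).1, le_rfl⟩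
      rw [← hφA] at hmemA
      obtain ⟨b, hb⟩ := hmemA
      have := hu.2.2 b (mem_univ b)
      simpa [x, y, z, t, hb] using this)
    (fun B k hB => by
      by_contra! hc
      obtain ⟨u, hu, hle⟩ := exists_mem_coverSet_iUnion ht m (monotone_inter_coord_le B k) hc
      rw [iUnion_inter_coord_le] at hu
      exact (hB u hu).not_ge hle)
  have hr : ∀ k : ℕ, (0 : ℝ) ≤ (k : ℝ) + 1 := fun k => by positivity
  let c : ℕ → C(X × X, ℝ) := fun k =>
    ⟨lipschitzHull z t {b | ∀ i < k, b i ≤ N i} ((k : ℝ) + 1),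
      continuous_lipschitzHull ht (hr k)⟩
  have hBanti : ∀ k l, k ≤ l →
      {b : ℕ → ℕ | ∀ i < l, b i ≤ N i} ⊆ {b | ∀ i < k, b i ≤ N i} :=
    fun k l hkl b hb i hi => hb i (hi.trans_le hkl)
  have hanti : Antitone c := fun k l hkl q =>
    lipschitzHull_anti ht (hr k) (by gcongr) (hBanti k l hkl) q
  obtain ⟨κ, hκ, hκα⟩ := exists_isCoupling_of_antitone μ ν c hanti α
    (fun k f g hf hg hfM hgM hle => by
      obtain ⟨f', g', hf', hg', hfm, hgm, hcov, hcost⟩ := exists_truncation μ ν hf hg hfM hgM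
        fun x y => (lipschitzHull_nonneg _).trans (hle x y)
      have hu : Sum.elim f' g' ∈ coverSet x y t {b | ∀ i < k, b i ≤ N i} := by
        refine ⟨hf'.sumElim hg', ?_, fun b hb => ?_⟩
        · rintro (ω | ω)
          exacts [hfm ω, hgm ω]
        · exact hcov _ _ _ (ht b) ((apply_le_lipschitzHull (z := z) ht (hr k) hb).trans
            (hle (z b).1 (z b).2))
      have hlt := hN k _ hu
      rw [integral_sumElim_measure μ ν hu.1 hu.2.1] at hlt
      exact hlt.trans_le hcost)
  have := hκ.1
  refine ⟨κ, hκ, ?_⟩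
  have hcbd : ∀ q, BddBelow (range fun k => c k q) := fun q =>
    ⟨0, by rintro _ ⟨k, rfl⟩; exact lipschitzHull_nonneg q⟩
  have hlim : ∀ q, Tendsto (fun k => c k q) atTop (𝓝 (⨅ k, c k q)) := fun q =>
    tendsto_atTop_ciInf (fun k l hkl => hanti hkl q) (hcbd q)
  have hcm : ∀ k, Measurable fun q => c k q := fun k => (c k).continuous.measurable
  have hcmem : ∀ k q, c k q ∈ Icc (0 : ℝ) 1 := fun k q =>
    ⟨lipschitzHull_nonneg q, lipschitzHull_le_one ht (hr k) q⟩
  have hLmem : ∀ q, ⨅ k, c k q ∈ Icc (0 : ℝ) 1 := fun q =>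
    isClosed_Icc.mem_of_tendsto (hlim q) (.of_forall fun k => hcmem k q)
  have hint : Tendsto (fun k => ∫ q, c k q ∂κ) atTop (𝓝 (∫ q, ⨅ k, c k q ∂κ)) :=
    tendsto_integral_of_dominated_convergence (fun _ => 1)
      (fun k => (hcm k).aestronglyMeasurable) (integrable_const _)
      (fun k => .of_forall fun q => by
        rw [Real.norm_eq_abs, abs_of_nonneg (hcmem k q).1]; exact (hcmem k q).2)
      (.of_forall hlim)
  refine (ge_of_tendsto' hint hκα).trans (integral_mono
    (.of_mem_Icc 0 1 (measurable_of_tendsto_metrizable hcm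
      (tendsto_pi_nhds.2 hlim)).aemeasurable (.of_forall hLmem))
    (.of_mem_Icc 0 1 hh.aemeasurable (.of_forall hmem)) fun q => ?_)
  exact iInf_lipschitzHull_le hz htc ht (fun q => (hmem q).1) (fun b => (hφmem b).2) N q

end Duality

section StandardBorel

variable {X : Type*} [MeasurableSpace X]

lemma exists_compact_metricSpace_of_measurableEquiv {Y : Type*} [TopologicalSpace Y]
    [CompactSpace Y] [TopologicalSpace.MetrizableSpace Y] [MeasurableSpace Y] [BorelSpace Y]
    (e : X ≃ᵐ Y) : ∃ _ : MetricSpace X, CompactSpace X ∧ BorelSpace X := by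
  let := TopologicalSpace.metrizableSpaceMetric Y
  let := MetricSpace.induced e e.injective inferInstance
  refine ⟨inferInstance, ?_, ⟨?_⟩⟩
  · exact (Topology.IsClosedEmbedding.mk ⟨⟨rfl⟩, e.injective⟩
      (by rw [e.surjective.range_eq]; exact isClosed_univ)).compactSpace
  · refine e.measurableEmbedding.comap_eq.symm.trans ?_
    exact (congrArg (MeasurableSpace.comap e) (BorelSpace.measurable_eq (α := Y))).trans
      borel_comap.symm

/-- Every standard Borel space carries a compact metric that generates its σ-algebra. -/
theorem exists_compact_metricSpace_borelSpace [StandardBorelSpace X] :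
    ∃ _ : MetricSpace X, CompactSpace X ∧ BorelSpace X := by
  by_cases hX : Countable X
  · rcases finite_or_infinite X with hfin | hinf
    · obtain ⟨n, ⟨e⟩⟩ := Finite.exists_equiv_fin X
      exact exists_compact_metricSpace_of_measurableEquiv (PolishSpace.Equiv.measurableEquiv e)
    · have : BorelSpace ℕ∞ := ⟨by
        ext s
        simp only [MeasurableSpace.measurableSet_top, true_iff]
        let := borel ℕ∞
        have : BorelSpace ℕ∞ := ⟨rfl⟩
        exact s.to_countable.measurableSet⟩
      have : Infinite ℕ∞ := Infinite.of_injective ((↑) : ℕ → ℕ∞) Nat.cast_injective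
      have := Encodable.ofCountable X
      have := Encodable.ofCountable ℕ∞
      have := Denumerable.ofEncodableOfInfinite X
      have := Denumerable.ofEncodableOfInfinite ℕ∞
      exact exists_compact_metricSpace_of_measurableEquiv
        (PolishSpace.Equiv.measurableEquiv (Denumerable.equiv₂ X ℕ∞))
  · exact exists_compact_metricSpace_of_measurableEquiv
      (PolishSpace.measurableEquivNatBoolOfNotCountable hX)

variable [StandardBorelSpace X]

lemma exists_isCoupling_le_integral (μ ν : Measure X) [IsProbabilityMeasure μ]
    [IsProbabilityMeasure ν]
    {h : X × X → ℝ} (hh : Measurable h) (hmem : ∀ q, h q ∈ Icc (0 : ℝ) 1) (α : ℝ)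
    (hα : ∀ f g : X → ℝ, Measurable f → Measurable g → (∀ x, f x ∈ Icc (0 : ℝ) 1) →
      (∀ x, g x ∈ Icc (0 : ℝ) 1) → (∀ x y, h (x, y) ≤ f x + g y) →
      α < ∫ x, f x ∂μ + ∫ x, g x ∂ν) :
    ∃ κ : Measure (X × X), IsCoupling κ μ ν ∧ α ≤ ∫ q, h q ∂κ := by
  obtain ⟨_, _, _⟩ := exists_compact_metricSpace_borelSpace (X := X)
  exact exists_isCoupling_le_integral_of_compactSpace μ ν hh hmem α hα

end StandardBorel

lemma UniversallyMeasurableFn.aemeasurable {X : Type*} [MeasurableSpace X] {h : X → ℝ}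
    (hh : UniversallyMeasurableFn h) (μ : Measure X) [hμ : IsProbabilityMeasure μ] :
    AEMeasurable h μ :=
  hh μ hμ

/-- The easy half of the duality. -/
lemma integral_sub_integral_le_of_isCoupling {X : Type*} [MeasurableSpace X] {d : X × X → ℝ}
    (hd_meas : Measurable d) (hd_mem : ∀ q, d q ∈ Set.Icc (0 : ℝ) 1) {μ ν : Measure X}
    [IsProbabilityMeasure μ] [IsProbabilityMeasure ν] {κ : Measure (X × X)}
    (hκ : IsCoupling κ μ ν) {h : X → ℝ} (hmem : ∀ x, h x ∈ Set.Icc (0 : ℝ) 1)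
    (hum : UniversallyMeasurableFn h) (hne : ∀ x y, h x - h y ≤ d (x, y)) :
    ∫ x, h x ∂μ - ∫ x, h x ∂ν ≤ ∫ q, d q ∂κ := by
  obtain ⟨hprob, rfl, rfl⟩ := hκ
  have h1 := hum.aemeasurable (κ.map Prod.fst)
  have h2 := hum.aemeasurable (κ.map Prod.snd)
  rw [integral_map measurable_fst.aemeasurable h1.aestronglyMeasurable,
    integral_map measurable_snd.aemeasurable h2.aestronglyMeasurable]
  have i1 : Integrable (fun q : X × X => h q.1) κ :=
    .of_mem_Icc 0 1 (h1.comp_measurable measurable_fst) (.of_forall fun _ => hmem _)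
  have i2 : Integrable (fun q : X × X => h q.2) κ :=
    .of_mem_Icc 0 1 (h2.comp_measurable measurable_snd) (.of_forall fun _ => hmem _)
  rw [← integral_sub i1 i2]
  exact integral_mono (i1.sub i2)
    (.of_mem_Icc 0 1 hd_meas.aemeasurable (.of_forall hd_mem)) fun q => hne q.1 q.2


/-- Kantorovich–Rubinstein duality on a standard Borel space: the Wasserstein lift of a
measurable `[0,1]`-valued pseudometric `d` equals the supremum of `∫ h dμ − ∫ h dν`
over all universally measurable `h : X → [0,1]` that are nonexpansive w.r.t. `d`. -/
theorem kantorovich_rubinstein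
    {X : Type*} [MeasurableSpace X] [StandardBorelSpace X]
    (d : X × X → ℝ) (hd_meas : Measurable d)
    (hd_mem : ∀ q, d q ∈ Set.Icc (0 : ℝ) 1)
    (hd_refl : ∀ x, d (x, x) = 0)
    (hd_symm : ∀ x y, d (x, y) = d (y, x))
    (hd_tri : ∀ x y z, d (x, z) ≤ d (x, y) + d (y, z))
    (μ ν : Measure X) [IsProbabilityMeasure μ] [IsProbabilityMeasure ν] :
    (⨅ κ : {κ : Measure (X × X) // IsCoupling κ μ ν}, ∫ q, d q ∂(κ.1)) =
      ⨆ h : {h : X → ℝ // (∀ x, h x ∈ Set.Icc (0 : ℝ) 1) ∧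
          UniversallyMeasurableFn h ∧ ∀ x y, h x - h y ≤ d (x, y)},
        (∫ x, h.1 x ∂μ - ∫ x, h.1 x ∂ν) := by
  have hne : Nonempty X := nonempty_of_isProbabilityMeasure μ
  have : Nonempty {κ : Measure (X × X) // IsCoupling κ μ ν} :=
    ⟨⟨μ.prod ν, inferInstance, by simp, by simp⟩⟩
  have : Nonempty {h : X → ℝ // (∀ x, h x ∈ Set.Icc (0 : ℝ) 1) ∧
      UniversallyMeasurableFn h ∧ ∀ x y, h x - h y ≤ d (x, y)} :=
    ⟨⟨fun _ => 0, fun _ => by simp, fun _ _ => ⟨_, measurable_const, .rfl⟩,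
      fun x y => by simpa using (hd_mem (x, y)).1⟩⟩
  have hle : ∀ (κ : {κ : Measure (X × X) // IsCoupling κ μ ν})
      (h : {h : X → ℝ // (∀ x, h x ∈ Set.Icc (0 : ℝ) 1) ∧
        UniversallyMeasurableFn h ∧ ∀ x y, h x - h y ≤ d (x, y)}),
      ∫ x, h.1 x ∂μ - ∫ x, h.1 x ∂ν ≤ ∫ q, d q ∂(κ.1) := fun κ h =>
    integral_sub_integral_le_of_isCoupling hd_meas hd_mem κ.2 h.2.1 h.2.2.1 h.2.2.2
  refine le_antisymm (le_of_not_gt fun hlt => ?_) (ciSup_le fun h => le_ciInf fun κ => hle κ h)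
  obtain ⟨β, hβ₁, hβ₂⟩ := exists_between hlt
  obtain ⟨κ, hκ, hκβ⟩ := exists_isCoupling_le_integral μ ν (h := fun q => 1 - d q)
    (hd_meas.const_sub 1) (fun q => ⟨by linarith [(hd_mem q).2], by linarith [(hd_mem q).1]⟩)
    (1 - β) (fun f g hf hg hfm hgm hfg => by
      have hc : Measurable fun q : X × X => d q + g q.2 := hd_meas.add (hg.comp measurable_snd)
      have hc0 : ∀ q : X × X, 0 ≤ d q + g q.2 := fun q => add_nonneg (hd_mem q).1 (hgm q.2).1
      have hbdd : ∀ x, BddBelow (Set.range fun y => d (x, y) + g y) := fun x =>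
        ⟨0, by rintro _ ⟨y, rfl⟩; exact hc0 (x, y)⟩
      let h : X → ℝ := fun x => ⨅ y, (d (x, y) + g y)
      have hhg : ∀ x, h x ≤ g x := fun x => by
        simpa [hd_refl] using ciInf_le (hbdd x) x
      have hfh : ∀ x, 1 - f x ≤ h x := fun x => le_ciInf fun y => by linarith [hfg x y]
      have hmem : ∀ x, h x ∈ Set.Icc (0 : ℝ) 1 := fun x =>
        ⟨le_ciInf fun y => hc0 (x, y), (hhg x).trans (hgm x).2⟩
      have hum : UniversallyMeasurableFn h := universallyMeasurableFn_iInf hc hc0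
      have hnonexp : ∀ x y, h x - h y ≤ d (x, y) := fun x y => by
        have : h x - d (x, y) ≤ h y := le_ciInf fun w => by
          linarith [ciInf_le (hbdd x) w, hd_tri x y w]
        linarith
      have hsup := le_ciSup (f := fun h : {h : X → ℝ // (∀ x, h x ∈ Set.Icc (0 : ℝ) 1) ∧
          UniversallyMeasurableFn h ∧ ∀ x y, h x - h y ≤ d (x, y)} =>
          ∫ x, h.1 x ∂μ - ∫ x, h.1 x ∂ν)
        ⟨_, by rintro _ ⟨h, rfl⟩; exact hle (Classical.arbitrary _) h⟩ ⟨h, hmem, hum, hnonexp⟩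
      have i1 : Integrable f μ := .of_mem_Icc 0 1 hf.aemeasurable (.of_forall hfm)
      have i2 : Integrable g ν := .of_mem_Icc 0 1 hg.aemeasurable (.of_forall hgm)
      have j : ∀ ρ : Measure X, IsProbabilityMeasure ρ → Integrable h ρ := fun ρ _ =>
        .of_mem_Icc 0 1 (hum.aemeasurable ρ) (.of_forall hmem)
      have h1 := integral_mono ((integrable_const 1).sub i1) (j μ inferInstance) hfh
      have h2 := integral_mono (j ν inferInstance) i2 hhg
      simp only [Pi.sub_apply] at h1
      rw [integral_sub (integrable_const 1) i1] at h1
      simp only [integral_const, probReal_univ, one_smul] at h1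
      dsimp only at hsup
      linarith)
  have := hκ.1
  have i : Integrable d κ := .of_mem_Icc 0 1 hd_meas.aemeasurable (.of_forall hd_mem)
  rw [integral_sub (integrable_const 1) i] at hκβ
  simp only [integral_const, probReal_univ, one_smul] at hκβ
  have hinf := ciInf_le (f := fun κ : {κ : Measure (X × X) // IsCoupling κ μ ν} =>
      ∫ q, d q ∂(κ.1)) ⟨_, by rintro _ ⟨κ, rfl⟩; exact hle κ (Classical.arbitrary _)⟩ ⟨κ, hκ⟩
  dsimp only at hinf
  linarith
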